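/- Assume that b_1, …, b_r are roots of unity and b_{r+1}, …, b_g are not. Set D_p(t) = (t² − 1) ∏_{i=1}^r (t − ρ_i)² and let f_p ∈ ℂ((t⁻¹)) be the square root of D_p with leading term t^{r+1}, so that f = (∏_{i=r+1}^g (t − ρ_i)) · f_p. Then the set of convergents (p, q) of f with q monic, with ord(p − q f) − deg q ≥ d − r, and which are NOT of the form p = c · P · ∏_{i=r+1}^g (t − ρ_i), q = c · Q for some c ∈ ℂ^× and some convergent (P, Q) of f_p, is finite. In other words, up to finitely many exceptions, every partial quotient of f of degree ≥ d − r is obtained from a convergent of f_p. -/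

import Mathlib

/-- The element `t` of `ℂ((t⁻¹))`: we model `ℂ((t⁻¹))` as the field `LaurentSeries ℂ` of formal
Laurent series in the variable `X = t⁻¹`, so `t` is the inverse of the variable,
i.e. the Hahn series `X⁻¹`. -/
noncomputable def tK : LaurentSeries ℂ := HahnSeries.single (-1 : ℤ) 1

/-- The embedding `ℂ[t] → ℂ((t⁻¹))`, sending a polynomial `p` to `p(t)`. -/
noncomputable def emb (p : Polynomial ℂ) : LaurentSeries ℂ := Polynomial.aeval tK p

/-- `ord(h)` = the order of vanishing at infinity: for `h = Σ_{n ≤ n₀} c_n tⁿ` nonzero it is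
`−max{n : c_n ≠ 0}`, i.e. the Hahn-series order (least exponent of `t⁻¹` in the support),
and `ord 0 = ⊤`. -/
noncomputable def ordE (h : LaurentSeries ℂ) : WithTop ℤ :=
  letI := Classical.propDecidable (h = 0)
  if h = 0 then ⊤ else (h.order : WithTop ℤ)

/-- `(p, q)` is a convergent of `f`: `p, q` are coprime polynomials, `q ≠ 0`, and
`ord(p − q f) ≥ deg q + 1`. -/
def IsConvergent (f : LaurentSeries ℂ) (p q : Polynomial ℂ) : Prop :=
  q ≠ 0 ∧ IsCoprime p q ∧
    (((q.natDegree : ℤ) + 1 : ℤ) : WithTop ℤ) ≤ ordE (emb p - emb q * f)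

open Polynomial in
theorem aeval_chebyshev_T_add_U_mul {A : Type*} [CommRing A] [Algebra ℂ A] {t s : A}
    (hs : s ^ 2 = t ^ 2 - 1) (n : ℕ) :
    aeval t (Chebyshev.T ℂ n) + aeval t (Chebyshev.U ℂ (n - 1)) * s = (t + s) ^ n := by
  induction n with
  | zero => simp
  | succ n ih =>
    have hT := congrArg (aeval t) (Chebyshev.T_eq_X_mul_T_sub_pol_U ℂ (n - 1))
    have hU := congrArg (aeval t) (Chebyshev.U_eq_X_mul_U_add_T ℂ (n - 1))
    rw [show (n : ℤ) - 1 + 2 = n + 1 by ring, show (n : ℤ) - 1 + 1 = n by ring] at hT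
    rw [show (n : ℤ) - 1 + 1 = n by ring] at hU
    simp only [map_sub, map_add, map_mul, map_one, map_pow, aeval_X] at hT hU
    rw [pow_succ, ← ih, Nat.cast_succ, show (n : ℤ) + 1 - 1 = n by ring, hT, hU]
    linear_combination -(aeval t (Chebyshev.U ℂ (n - 1))) * hs

theorem eval_chebyshev_U_eq_zero_iff {ρ β : ℂ} (h : β ^ 2 = ρ ^ 2 - 1) (hβ : β ≠ 0) (n : ℕ) :
    (Polynomial.Chebyshev.U ℂ (n - 1)).eval ρ = 0 ↔ (ρ + β) ^ (2 * n) = 1 := by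
  have h₁ := aeval_chebyshev_T_add_U_mul h n
  have h₂ := aeval_chebyshev_T_add_U_mul (t := ρ) (s := -β) (by rw [neg_sq, h]) n
  have h₃ : (ρ + β) ^ n * (ρ + -β) ^ n = 1 := by
    rw [← mul_pow, show (ρ + β) * (ρ + -β) = 1 by linear_combination -h, one_pow]
  have hne : (ρ + β) ^ n ≠ 0 := left_ne_zero_of_mul_eq_one h₃
  simp only [Polynomial.coe_aeval_eq_eval] at h₁ h₂
  have key : (ρ + β) ^ n * (2 * β * (Polynomial.Chebyshev.U ℂ (n - 1)).eval ρ) =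
      (ρ + β) ^ (2 * n) - 1 := by
    rw [two_mul n, pow_add]
    linear_combination (ρ + β) ^ n * (h₁ - h₂) - h₃
  rw [← sub_eq_zero (b := (1 : ℂ)), ← key]
  simp [hne, hβ]

theorem natDegree_chebyshev_U_le {n : ℕ} (hn : 0 < n) :
    (Polynomial.Chebyshev.U ℂ (n - 1)).natDegree ≤ n - 1 := by
  rw [Polynomial.Chebyshev.natDegree_U]
  omega

theorem natDegree_chebyshev_T_le (n : ℕ) : (Polynomial.Chebyshev.T ℂ n).natDegree ≤ n := by
  simp

theorem ordE_eq_orderTop (h : LaurentSeries ℂ) : ordE h = h.orderTop := by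
  unfold ordE
  split_ifs with h0
  · simp [h0]
  · exact HahnSeries.order_eq_orderTop_of_ne_zero h0

theorem le_orderTop_mul {x y : LaurentSeries ℂ} {a b c : ℤ} (hx : (a : WithTop ℤ) ≤ x.orderTop)
    (hy : (b : WithTop ℤ) ≤ y.orderTop) (h : c ≤ a + b) : (c : WithTop ℤ) ≤ (x * y).orderTop :=
  calc (c : WithTop ℤ) ≤ ((a + b : ℤ) : WithTop ℤ) := WithTop.coe_le_coe.2 h
    _ ≤ x.orderTop + y.orderTop := by rw [WithTop.coe_add]; exact add_le_add hx hy
    _ ≤ _ := HahnSeries.orderTop_add_le_mul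

theorem le_orderTop_add {x y : LaurentSeries ℂ} {c : WithTop ℤ} (hx : c ≤ x.orderTop)
    (hy : c ≤ y.orderTop) : c ≤ (x + y).orderTop :=
  (le_min hx hy).trans HahnSeries.min_orderTop_le_orderTop_add

theorem le_orderTop_sub {x y : LaurentSeries ℂ} {c : WithTop ℤ} (hx : c ≤ x.orderTop)
    (hy : c ≤ y.orderTop) : c ≤ (x - y).orderTop :=
  (le_min hx hy).trans HahnSeries.min_orderTop_le_orderTop_sub

theorem emb_mul (p q : Polynomial ℂ) : emb (p * q) = emb p * emb q := map_mul _ _ _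

theorem emb_add (p q : Polynomial ℂ) : emb (p + q) = emb p + emb q := map_add _ _ _

theorem emb_sub (p q : Polynomial ℂ) : emb (p - q) = emb p - emb q := map_sub _ _ _

theorem coeff_emb_monomial (n : ℕ) (a : ℂ) (j : ℤ) :
    (emb (Polynomial.monomial n a)).coeff j = if j = -(n : ℤ) then a else 0 := by
  have hC : algebraMap ℂ (LaurentSeries ℂ) a = HahnSeries.C a := HahnSeries.ofPowerSeries_C a
  rw [emb, Polynomial.aeval_monomial, tK, HahnSeries.single_pow, hC, HahnSeries.C_mul_eq_smul,
    HahnSeries.coeff_smul, HahnSeries.coeff_single]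
  simp

theorem coeff_emb (p : Polynomial ℂ) (k : ℕ) : (emb p).coeff (-(k : ℤ)) = p.coeff k := by
  induction p using Polynomial.induction_on' with
  | add p q hp hq => rw [emb_add, HahnSeries.coeff_add, hp, hq, Polynomial.coeff_add]
  | monomial n a =>
    simp [coeff_emb_monomial, Polynomial.coeff_monomial, eq_comm]

theorem coeff_emb_of_pos (p : Polynomial ℂ) {j : ℤ} (hj : 0 < j) : (emb p).coeff j = 0 := by
  induction p using Polynomial.induction_on' with
  | add p q hp hq => rw [emb_add, HahnSeries.coeff_add, hp, hq, add_zero]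
  | monomial n a =>
    rw [coeff_emb_monomial, if_neg (by omega)]

theorem le_orderTop_emb {p : Polynomial ℂ} {n : ℤ} (h : (p.natDegree : ℤ) ≤ n) :
    ((-n : ℤ) : WithTop ℤ) ≤ (emb p).orderTop := by
  rw [HahnSeries.le_orderTop_iff_forall]
  intro j hj
  have hj : j < -n := WithTop.coe_lt_coe.1 hj
  obtain ⟨k, rfl⟩ : ∃ k : ℕ, j = -(k : ℤ) := ⟨(-j).toNat, by omega⟩
  rw [coeff_emb, Polynomial.coeff_eq_zero_of_natDegree_lt (by omega)]

theorem degree_lt_of_le_orderTop_emb {p : Polynomial ℂ} {n : ℕ}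
    (h : ((1 - n : ℤ) : WithTop ℤ) ≤ (emb p).orderTop) : p.degree < n := by
  rw [Polynomial.degree_lt_iff_coeff_zero]
  intro k hk
  rw [← coeff_emb]
  exact HahnSeries.le_orderTop_iff_forall.1 h _ (WithTop.coe_lt_coe.2 (by omega))

theorem orderTop_emb {p : Polynomial ℂ} (hp : p ≠ 0) :
    (emb p).orderTop = ((-p.natDegree : ℤ) : WithTop ℤ) :=
  le_antisymm (HahnSeries.orderTop_le_of_coeff_ne_zero (by
    rw [coeff_emb]; exact Polynomial.leadingCoeff_ne_zero.2 hp)) (le_orderTop_emb le_rfl)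

theorem emb_ne_zero {p : Polynomial ℂ} (hp : p ≠ 0) : emb p ≠ 0 :=
  HahnSeries.orderTop_ne_top.1 (by rw [orderTop_emb hp]; exact WithTop.coe_ne_top)

theorem order_emb {p : Polynomial ℂ} (hp : p ≠ 0) : (emb p).order = -p.natDegree :=
  WithTop.coe_injective ((HahnSeries.order_eq_orderTop_of_ne_zero (emb_ne_zero hp)).trans
    (orderTop_emb hp))

theorem emb_X_sq_sub_one : emb (Polynomial.X ^ 2 - 1) = tK ^ 2 - 1 := by simp [emb]

theorem one_le_orderTop_tK_sub {s : LaurentSeries ℂ} (hs : s ^ 2 = tK ^ 2 - 1)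
    (h1 : s.coeff (-1) = 1) : ((1 : ℤ) : WithTop ℤ) ≤ (tK - s).orderTop := by
  have hmul : (tK - s) * (tK + s) = 1 := by linear_combination -hs
  have hx : tK - s ≠ 0 := left_ne_zero_of_mul_eq_one hmul
  have hy : tK + s ≠ 0 := right_ne_zero_of_mul_eq_one hmul
  have hc : (tK + s).coeff (-1) ≠ 0 := by
    rw [HahnSeries.coeff_add, h1, tK, HahnSeries.coeff_single_same]
    norm_num
  have hle := HahnSeries.order_le_of_coeff_ne_zero hc
  have hord := congrArg HahnSeries.order hmul
  rw [HahnSeries.order_mul hx hy, HahnSeries.order_one] at hord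
  rw [← HahnSeries.order_eq_orderTop_of_ne_zero hx]
  exact WithTop.coe_le_coe.2 (by omega)

theorem coeff_neg_one_eq_one {p : Polynomial ℂ} (hp : p.Monic) {s : LaurentSeries ℂ}
    (hs : s ^ 2 = tK ^ 2 - 1) (h : (emb p * s).coeff (-((p.natDegree + 1 : ℕ) : ℤ)) = 1) :
    s.coeff (-1) = 1 := by
  have hdeg : (Polynomial.X ^ 2 - 1 : Polynomial ℂ).natDegree = 2 := by compute_degree!
  have h0 : (Polynomial.X ^ 2 - 1 : Polynomial ℂ) ≠ 0 := by
    rintro h0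
    simp [h0] at hdeg
  have hs0 : s ≠ 0 := by
    rintro rfl
    apply emb_ne_zero h0
    rw [emb_X_sq_sub_one, ← hs]
    simp
  have hord := congrArg HahnSeries.order hs
  rw [← emb_X_sq_sub_one, order_emb h0, hdeg, sq, HahnSeries.order_mul hs0 hs0] at hord
  have hord : s.order = -1 := by push_cast at hord; omega
  have hlead := HahnSeries.coeff_mul_order_add_order (emb p) s
  rw [HahnSeries.leadingCoeff_eq, HahnSeries.leadingCoeff_eq, order_emb hp.ne_zero, hord,
    coeff_emb, hp.coeff_natDegree, one_mul] at hlead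
  rw [← hlead, ← h]
  congr 1
  push_cast
  ring

/-- Two monic convergents of the same degree coincide. -/
theorem IsConvergent.eq_of_natDegree_eq {f : LaurentSeries ℂ} {p q p' q' : Polynomial ℂ}
    (h : IsConvergent f p q) (h' : IsConvergent f p' q') (hq : q.Monic) (hq' : q'.Monic)
    (hdeg : q.natDegree = q'.natDegree) : p = p' ∧ q = q' := by
  obtain ⟨h0, hcop, hord⟩ := h
  obtain ⟨h0', hcop', hord'⟩ := h'
  rw [ordE_eq_orderTop] at hord hord'
  have hz : p * q' - p' * q = 0 := by
    rw [← Polynomial.degree_eq_bot, ← Nat.WithBot.lt_zero_iff]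
    refine degree_lt_of_le_orderTop_emb (n := 0) ?_
    rw [show emb (p * q' - p' * q) =
      (emb p - emb q * f) * emb q' - (emb p' - emb q' * f) * emb q by
        rw [emb_sub, emb_mul, emb_mul]; ring]
    exact le_orderTop_sub
      (le_orderTop_mul hord (le_orderTop_emb le_rfl) (by push_cast; omega))
      (le_orderTop_mul hord' (le_orderTop_emb le_rfl) (by push_cast; omega))
  have hz : p * q' = p' * q := sub_eq_zero.1 hz
  have hqq : q = q' := Polynomial.eq_of_monic_of_associated hq hq' (associated_of_dvd_dvd
    (hcop.symm.dvd_of_dvd_mul_left ⟨p', by rw [hz, mul_comm]⟩)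
    (hcop'.symm.dvd_of_dvd_mul_left ⟨p, by rw [← hz, mul_comm]⟩))
  subst hqq
  exact ⟨mul_right_cancel₀ h0 hz, rfl⟩

/-- If `(P R, q)` is a convergent of `R φ`, then `(P, q)` is a convergent of `φ`. -/
theorem IsConvergent.of_mul {φ : LaurentSeries ℂ} {P q R : Polynomial ℂ} (hR : R ≠ 0)
    (h : IsConvergent (emb R * φ) (P * R) q) : IsConvergent φ P q := by
  obtain ⟨h0, hcop, hord⟩ := h
  refine ⟨h0, hcop.of_mul_left_left, ?_⟩
  rw [ordE_eq_orderTop] at hord ⊢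
  rw [show emb (P * R) - emb q * (emb R * φ) = emb R * (emb P - emb q * φ) by
    rw [emb_mul]; ring, HahnSeries.orderTop_mul, orderTop_emb hR] at hord
  refine hord.trans ?_
  calc _ ≤ 0 + (emb P - emb q * φ).orderTop := by
        gcongr
        exact WithTop.coe_le_coe.2 (by omega)
    _ = _ := zero_add _

/-- Multiplying by the Pell unit `(t - s) ^ n` of order `n` relates convergents of `D₁ s`
whose denominators have degrees differing by `n`: the numerators cannot both be nonzero at a root of
`D₁` at which `U_{n-1}` does not vanish. -/
theorem eval_mul_eval_mul_eval_eq_zero {D₁ : Polynomial ℂ} {s : LaurentSeries ℂ}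
    (hs : s ^ 2 = tK ^ 2 - 1) (hts : ((1 : ℤ) : WithTop ℤ) ≤ (tK - s).orderTop)
    {p q p' q' : Polynomial ℂ} {n r : ℕ} (hn : 0 < n) (hdeg : q'.natDegree = q.natDegree + n)
    (hr : r ≤ D₁.natDegree)
    (hord : ((q.natDegree + D₁.natDegree + 1 - r : ℤ) : WithTop ℤ) ≤
      (emb p - emb q * (emb D₁ * s)).orderTop)
    (hord' : ((q'.natDegree + D₁.natDegree + 1 - r : ℤ) : WithTop ℤ) ≤
      (emb p' - emb q' * (emb D₁ * s)).orderTop)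
    {S : Finset ℂ} (hS : S.card = r) (hSD : ∀ x ∈ S, D₁.eval x = 0)
    (hSU : ∀ x ∈ S, (Polynomial.Chebyshev.U ℂ (n - 1)).eval x = 0)
    {z : ℂ} (hz : D₁.eval z = 0) :
    p'.eval z * (p.eval z * (Polynomial.Chebyshev.U ℂ (n - 1)).eval z) = 0 := by
  set T := Polynomial.Chebyshev.T ℂ n
  set U := Polynomial.Chebyshev.U ℂ (n - 1)
  have hTd : T.natDegree ≤ n := natDegree_chebyshev_T_le n
  have hUd : U.natDegree ≤ n - 1 := natDegree_chebyshev_U_le hn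
  have hunit : emb T - emb U * s = (tK - s) ^ n := by
    have := aeval_chebyshev_T_add_U_mul (t := tK) (s := -s) (by linear_combination hs) n
    rw [show tK - s = tK + -s by ring, ← this, emb, emb]
    ring
  have hunit_ord : ((n : ℤ) : WithTop ℤ) ≤ (emb T - emb U * s).orderTop := by
    rw [hunit]
    refine le_trans ?_ HahnSeries.orderTop_nsmul_le_orderTop_pow
    calc ((n : ℤ) : WithTop ℤ) = n • ((1 : ℤ) : WithTop ℤ) := by simp
      _ ≤ _ := nsmul_le_nsmul_right hts n
  have htK : ((-1 : ℤ) : WithTop ℤ) ≤ tK.orderTop := HahnSeries.orderTop_single_le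
  have hs_ord : ((-1 : ℤ) : WithTop ℤ) ≤ s.orderTop := by
    rw [show s = tK - (tK - s) by ring]
    exact le_orderTop_sub htK ((WithTop.coe_le_coe.2 (by norm_num)).trans hts)
  have hpd : p.natDegree ≤ q.natDegree + D₁.natDegree + 1 := by
    have hp : p.degree < (q.natDegree + D₁.natDegree + 2 : ℕ) := by
      refine degree_lt_of_le_orderTop_emb ?_
      rw [show emb p = (emb p - emb q * (emb D₁ * s)) + emb q * (emb D₁ * s) by ring]
      refine le_orderTop_add ((WithTop.coe_le_coe.2 ?_).trans hord)
        (le_orderTop_mul (le_orderTop_emb le_rfl)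
          (le_orderTop_mul (le_orderTop_emb le_rfl) hs_ord le_rfl) ?_)
      all_goals push_cast; omega
    rw [Polynomial.natDegree_le_iff_coeff_eq_zero]
    exact fun k hk ↦ Polynomial.degree_lt_iff_coeff_zero _ _ |>.1 hp k hk
  set V := p * U + q * D₁ * T with hV
  have hVd : V.natDegree ≤ q.natDegree + D₁.natDegree + n := by
    refine Polynomial.natDegree_add_le_of_degree_le ?_ ?_
    · exact Polynomial.natDegree_mul_le.trans (by omega)
    · have := Polynomial.natDegree_mul_le (p := q) (q := D₁)
      exact Polynomial.natDegree_mul_le.trans (by omega)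
  set E := (p * T + q * D₁ * U * (Polynomial.X ^ 2 - 1)) * (q' * D₁) - p' * V with hE
  have hEd : E.degree < r := by
    refine degree_lt_of_le_orderTop_emb ?_
    have : emb E = (emb p - emb q * (emb D₁ * s)) * (emb T - emb U * s) * emb (q' * D₁) -
        (emb p' - emb q' * (emb D₁ * s)) * emb V := by
      simp only [hE, hV, emb_sub, emb_add, emb_mul]
      rw [← emb_sub, emb_X_sq_sub_one]
      linear_combination -emb q * emb D₁ * emb U * emb q' * emb D₁ * hs
    rw [this]
    refine le_orderTop_sub (le_orderTop_mul (le_orderTop_mul hord hunit_ord le_rfl)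
      (le_orderTop_emb (n := q'.natDegree + D₁.natDegree) ?_) ?_)
      (le_orderTop_mul hord' (le_orderTop_emb (n := q.natDegree + D₁.natDegree + n) ?_) ?_)
    · exact_mod_cast Polynomial.natDegree_mul_le
    · push_cast [hdeg]; omega
    · exact_mod_cast hVd
    · push_cast [hdeg]; omega
  have heval {x : ℂ} (hx : D₁.eval x = 0) :
      E.eval x = -(p'.eval x * (p.eval x * U.eval x)) := by
    simp [hE, hV, hx]
  have hE0 : E = 0 := by
    refine Polynomial.eq_zero_of_degree_lt_of_eval_finset_eq_zero S (by rwa [hS]) fun x hx ↦ ?_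
    rw [heval (hSD x hx), hSU x hx]
    simp
  have := heval hz
  rw [hE0, Polynomial.eval_zero] at this
  exact neg_eq_zero.1 this.symm

/-- Up to finitely many exceptions, every partial quotient of `√D` of degree `≥ d − r` comes
from a convergent of the Pellian part `√D_p`. -/
theorem stmt11 (g : ℕ) (hg : 1 ≤ g) (ρ β b : Fin g → ℂ)
    (hρdist : Function.Injective ρ) (hρ1 : ∀ i, ρ i ≠ 1 ∧ ρ i ≠ -1)
    (hβ : ∀ i, β i ^ 2 = ρ i ^ 2 - 1) (hbdef : ∀ i, b i = ρ i + β i)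
    (hbinj : Function.Injective b) (hbInv : ∀ i j, b i ≠ (b j)⁻¹)
    (D₁ D : Polynomial ℂ)
    (hD₁ : D₁ = ∏ i, (Polynomial.X - Polynomial.C (ρ i)))
    (hD : D = (Polynomial.X ^ 2 - 1) * D₁ ^ 2)
    (d : ℕ) (hd : d = g + 1)
    (f : LaurentSeries ℂ) (hf2 : f ^ 2 = emb D) (hlead : f.coeff (-(d : ℤ)) = 1)
    (r : ℕ) (hrg : r ≤ g)
    (hroots : ∀ i : Fin g, (i : ℕ) < r → ∃ m : ℕ, 0 < m ∧ b i ^ m = 1)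
    (hnroots : ∀ i : Fin g, r ≤ (i : ℕ) → ∀ m : ℕ, 0 < m → b i ^ m ≠ 1)
    (Dp : Polynomial ℂ)
    (hDp : Dp = (Polynomial.X ^ 2 - 1) *
      (∏ i ∈ Finset.univ.filter (fun i : Fin g => (i : ℕ) < r),
        (Polynomial.X - Polynomial.C (ρ i))) ^ 2)
    (fp : LaurentSeries ℂ) (hfp2 : fp ^ 2 = emb Dp)
    (hfplead : fp.coeff (-((r : ℤ) + 1)) = 1)
    (hffp : f = emb (∏ i ∈ Finset.univ.filter (fun i : Fin g => r ≤ (i : ℕ)),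
      (Polynomial.X - Polynomial.C (ρ i))) * fp) :
    {pq : Polynomial ℂ × Polynomial ℂ |
      IsConvergent f pq.1 pq.2 ∧ pq.2.Monic ∧
        (((pq.2.natDegree : ℤ) + d - r : ℤ) : WithTop ℤ) ≤
          ordE (emb pq.1 - emb pq.2 * f) ∧
        ¬∃ c : ℂ, c ≠ 0 ∧ ∃ P Q : Polynomial ℂ, IsConvergent fp P Q ∧
          pq.1 = Polynomial.C c * P *
            ∏ i ∈ Finset.univ.filter (fun i : Fin g => r ≤ (i : ℕ)),
              (Polynomial.X - Polynomial.C (ρ i)) ∧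
          pq.2 = Polynomial.C c * Q}.Finite := by
  have hD₁m : D₁.Monic := hD₁ ▸ Polynomial.monic_prod_of_monic _ _ fun i _ ↦
    Polynomial.monic_X_sub_C _
  have hD₁d : D₁.natDegree = g := by simp [hD₁]
  have hD₁ev (i : Fin g) : D₁.eval (ρ i) = 0 := by
    rw [hD₁, Polynomial.eval_prod]
    exact Finset.prod_eq_zero (Finset.mem_univ i) (by simp)
  set R := ∏ i ∈ Finset.univ.filter (fun i : Fin g => r ≤ (i : ℕ)),
    (Polynomial.X - Polynomial.C (ρ i)) with hR
  have hRm : R.Monic := Polynomial.monic_prod_of_monic _ _ fun i _ ↦ Polynomial.monic_X_sub_C _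
  obtain ⟨s, rfl⟩ : ∃ s, f = emb D₁ * s :=
    ⟨(emb D₁)⁻¹ * f, (mul_inv_cancel_left₀ (emb_ne_zero hD₁m.ne_zero) f).symm⟩
  have hs : s ^ 2 = tK ^ 2 - 1 := by
    have h0 : emb D₁ ^ 2 ≠ 0 := pow_ne_zero 2 (emb_ne_zero hD₁m.ne_zero)
    refine mul_left_cancel₀ h0 ?_
    rw [← mul_pow, hf2, hD, pow_two D₁, emb_mul, emb_mul, emb_X_sq_sub_one]
    ring
  have hts := one_le_orderTop_tK_sub hs (coeff_neg_one_eq_one hD₁m hs (by rw [hD₁d, ← hd, hlead]))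
  have hβ0 (i : Fin g) : β i ≠ 0 := by
    intro h0
    have h := hβ i
    rw [h0, zero_pow two_ne_zero, eq_comm, sub_eq_zero, sq_eq_one_iff] at h
    exact h.elim (hρ1 i).1 (hρ1 i).2
  obtain ⟨m, hm, hbm⟩ : ∃ m : ℕ, 0 < m ∧ ∀ i : Fin g, (i : ℕ) < r → b i ^ m = 1 := by
    choose! e he0 he using hroots
    refine ⟨∏ i ∈ Finset.univ.filter (fun i : Fin g => (i : ℕ) < r), e i,
      Finset.prod_pos fun i hi ↦ he0 i (Finset.mem_filter.1 hi).2, fun i hi ↦ ?_⟩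
    obtain ⟨c, hc⟩ := Finset.dvd_prod_of_mem e
      (Finset.mem_filter.2 ⟨Finset.mem_univ i, hi⟩ :
        i ∈ Finset.univ.filter (fun i : Fin g => (i : ℕ) < r))
    rw [hc, pow_mul, he i hi, one_pow]
  set E : Set (Polynomial ℂ × Polynomial ℂ) := {pq | IsConvergent (emb D₁ * s) pq.1 pq.2 ∧
    pq.2.Monic ∧ (((pq.2.natDegree : ℤ) + d - r : ℤ) : WithTop ℤ) ≤
      ordE (emb pq.1 - emb pq.2 * (emb D₁ * s))} with hE
  have hdegree {i : Fin g} (hi : r ≤ (i : ℕ)) {x y : Polynomial ℂ × Polynomial ℂ}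
      (hx : x ∈ E) (hy : y ∈ E) (hxi : x.1.eval (ρ i) ≠ 0) (hyi : y.1.eval (ρ i) ≠ 0)
      (hmod : x.2.natDegree ≡ y.2.natDegree [MOD m]) : ¬x.2.natDegree < y.2.natDegree := by
    intro hlt
    obtain ⟨k, hk⟩ := (Nat.modEq_iff_dvd' hlt.le).1 hmod
    have hn : 0 < m * k := by omega
    have hordx := hx.2.2
    have hordy := hy.2.2
    rw [ordE_eq_orderTop, hd] at hordx hordy
    have hcard : ((Finset.univ.filter (fun i : Fin g => (i : ℕ) < r)).image ρ).card = r := by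
      rw [Finset.card_image_of_injective _ hρdist, Fin.card_filter_val_lt, min_eq_right hrg]
    have hU : (Polynomial.Chebyshev.U ℂ ((m * k : ℕ) - 1)).eval (ρ i) ≠ 0 := by
      rw [Ne, eval_chebyshev_U_eq_zero_iff (hβ i) (hβ0 i), ← hbdef]
      exact hnroots i hi _ (by omega)
    refine mul_ne_zero hyi (mul_ne_zero hxi hU) (eval_mul_eval_mul_eval_eq_zero hs hts hn
      (q := x.2) (q' := y.2) (by omega) (hD₁d ▸ hrg) ?_ ?_ hcard ?_ ?_ (hD₁ev i))
    · refine (WithTop.coe_le_coe.2 ?_).trans hordx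
      push_cast; omega
    · refine (WithTop.coe_le_coe.2 ?_).trans hordy
      push_cast; omega
    · simp only [Finset.mem_image]
      rintro _ ⟨j, -, rfl⟩
      exact hD₁ev j
    · simp only [Finset.mem_image, Finset.mem_filter]
      rintro _ ⟨j, ⟨-, hj⟩, rfl⟩
      rw [eval_chebyshev_U_eq_zero_iff (hβ j) (hβ0 j), ← hbdef,
        show 2 * (m * k) = m * (2 * k) by ring, pow_mul, hbm j hj, one_pow]
  have hfin (i : Fin g) (hi : r ≤ (i : ℕ)) : {x ∈ E | x.1.eval (ρ i) ≠ 0}.Finite := by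
    refine Set.Finite.of_finite_image (f := fun x ↦ x.2.natDegree % m)
      ((Set.finite_Iio m).subset ?_) ?_
    · rintro _ ⟨x, -, rfl⟩
      exact Nat.mod_lt _ hm
    · rintro x ⟨hx, hxi⟩ y ⟨hy, hyi⟩ hmod
      have hxy := hdegree hi hx hy hxi hyi hmod
      have hyx := hdegree hi hy hx hyi hxi hmod.symm
      obtain ⟨h₁, h₂⟩ := hx.1.eq_of_natDegree_eq hy.1 hx.2.1 hy.2.1 (by omega)
      exact Prod.ext h₁ h₂
  refine (Set.finite_iUnion fun i : {i : Fin g // r ≤ (i : ℕ)} ↦ hfin i i.2).subset ?_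
  rintro ⟨p, q⟩ ⟨hconv, hmon, hord, hex⟩
  by_contra hnot
  have hroot (i : Fin g) (hi : r ≤ (i : ℕ)) : p.eval (ρ i) = 0 := by
    by_contra hpi
    exact hnot (Set.mem_iUnion.2 ⟨⟨i, hi⟩, ⟨hconv, hmon, hord⟩, hpi⟩)
  obtain ⟨P, rfl⟩ : R ∣ p := Finset.prod_dvd_of_coprime
    (fun i _ j _ hij ↦ Polynomial.pairwise_coprime_X_sub_C hρdist hij)
    fun i hi ↦ Polynomial.dvd_iff_isRoot.2 (hroot i (Finset.mem_filter.1 hi).2)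
  rw [hffp, mul_comm R P] at hconv
  exact hex ⟨1, one_ne_zero, P, q, hconv.of_mul hRm.ne_zero, by simp [mul_comm], by simp⟩
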